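/- Let (W,S) be a Coxeter system with length function ℓ and Bruhat order ≤. If x, y, w ∈ W satisfy ℓ(xy) = ℓ(x) + ℓ(y) and ℓ(xw) = ℓ(x) + ℓ(w), then y ≤ w if and only if xy ≤ xw. -/

import Mathlib

/-- The Bruhat order on a Coxeter group: the partial order generated by the
relations `u < u * t` whenever `t` is a reflection (a conjugate of a simple
reflection) and `ℓ(u) < ℓ(u * t)`. -/
def CoxeterSystem.bruhatLE {B W : Type*} [Group W] {M : CoxeterMatrix B}
    (cs : CoxeterSystem M W) : W → W → Prop :=
  Relation.ReflTransGen fun u v =>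
    ∃ t : W, cs.IsReflection t ∧ v = u * t ∧ cs.length u < cs.length v

namespace CoxeterSystem

variable {B W : Type*} [Group W] {M : CoxeterMatrix B} (cs : CoxeterSystem M W)

open Classical in
/-- The involution of `W × ZMod 2` attached to a simple reflection `s`: it conjugates the first
component by `s`, and flips the second component when the first one is `s`. -/
noncomputable def signedConj (i : B) : Equiv.Perm (W × ZMod 2) :=
  Function.Involutive.toPerm
    (fun p => (cs.simple i * p.1 * cs.simple i, p.2 + if p.1 = cs.simple i then 1 else 0)) (by
      rintro ⟨t, e⟩
      have h : cs.simple i * t * cs.simple i = cs.simple i ↔ t = cs.simple i := by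
        constructor
        · intro h
          have := congrArg (fun a => cs.simple i * a * cs.simple i) h
          simpa [mul_assoc] using this
        · rintro rfl
          simp
      simp only [h, Prod.mk.injEq]
      refine ⟨by simp [mul_assoc], ?_⟩
      rw [add_assoc, CharTwo.add_self_eq_zero, add_zero])

open Classical in
theorem signedConj_apply (i : B) (t : W) (e : ZMod 2) :
    cs.signedConj i (t, e) =
      (cs.simple i * t * cs.simple i, e + if t = cs.simple i then 1 else 0) := rfl

theorem simple_mul_pow_mul_simple (i j : B) (n : ℕ) :
    cs.simple j * (cs.simple i * cs.simple j) ^ n =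
      (cs.simple j * cs.simple i) ^ n * cs.simple j := by
  induction n with
  | zero => simp
  | succ n ih => rw [pow_succ', pow_succ', mul_assoc _ _ (cs.simple j), ← ih]; simp [mul_assoc]

open Classical in
theorem signedConj_mul_pow_apply (i j : B) (n : ℕ) (t : W) (e : ZMod 2) :
    ((cs.signedConj i * cs.signedConj j) ^ n) (t, e) =
      ((cs.simple i * cs.simple j) ^ n * t * (cs.simple j * cs.simple i) ^ n,
        e + ∑ k ∈ Finset.range (2 * n),
          if t = (cs.simple j * cs.simple i) ^ k * cs.simple j then 1 else 0) := by
  induction n with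
  | zero => simp
  | succ n ih =>
    have hinv : (cs.simple i * cs.simple j) ^ n = ((cs.simple j * cs.simple i) ^ n)⁻¹ := by
      rw [← inv_pow]; simp
    have hconj (a : W) : (cs.simple i * cs.simple j) ^ n * t * (cs.simple j * cs.simple i) ^ n = a ↔
        t = (cs.simple j * cs.simple i) ^ n * a * (cs.simple i * cs.simple j) ^ n := by
      rw [hinv]
      constructor
      · rintro rfl; group
      · rintro rfl; group
    have h₁ : (cs.simple i * cs.simple j) ^ n * t * (cs.simple j * cs.simple i) ^ n = cs.simple j ↔
        t = (cs.simple j * cs.simple i) ^ (2 * n) * cs.simple j := by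
      rw [hconj, mul_assoc, simple_mul_pow_mul_simple, ← mul_assoc, ← pow_add, two_mul]
    have h₂ : cs.simple j * ((cs.simple i * cs.simple j) ^ n * t *
          (cs.simple j * cs.simple i) ^ n) * cs.simple j = cs.simple i ↔
        t = (cs.simple j * cs.simple i) ^ (2 * n + 1) * cs.simple j := by
      have hs (a : W) : cs.simple j * a * cs.simple j = cs.simple i ↔
          a = cs.simple j * cs.simple i * cs.simple j := by
        constructor
        · intro h; rw [← h]; simp [mul_assoc]
        · rintro rfl; simp [mul_assoc]
      rw [hs, hconj, mul_assoc, mul_assoc, mul_assoc, simple_mul_pow_mul_simple,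
        ← mul_assoc (cs.simple j), ← mul_assoc, ← mul_assoc, ← pow_succ, ← pow_add]
      rw [show n + 1 + n = 2 * n + 1 by omega]
    rw [pow_succ', Equiv.Perm.mul_apply, ih, Equiv.Perm.mul_apply, signedConj_apply,
      signedConj_apply, show 2 * (n + 1) = 2 * n + 1 + 1 by ring, Finset.sum_range_succ,
      Finset.sum_range_succ]
    simp only [h₁, h₂, Prod.mk.injEq]
    refine ⟨?_, by ring⟩
    rw [pow_succ', pow_succ]
    simp only [mul_assoc]

theorem isLiftable_signedConj : M.IsLiftable cs.signedConj := by
  classical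
  intro i j
  have h : (cs.simple j * cs.simple i) ^ M i j = 1 := by
    rw [M.symmetric i j]
    exact cs.simple_mul_simple_pow j i
  ext1 ⟨t, e⟩
  rw [signedConj_mul_pow_apply, h, cs.simple_mul_simple_pow, two_mul, Finset.sum_range_add]
  simp only [pow_add, h, one_mul, mul_one, CharTwo.add_self_eq_zero, add_zero,
    Equiv.Perm.coe_one, id_eq]

/-- The action of `W` on `W × ZMod 2` extending `signedConj`. -/
noncomputable def signedConjHom : W →* Equiv.Perm (W × ZMod 2) :=
  cs.lift ⟨cs.signedConj, cs.isLiftable_signedConj⟩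

theorem signedConjHom_simple (i : B) : cs.signedConjHom (cs.simple i) = cs.signedConj i :=
  cs.lift_apply_simple cs.isLiftable_signedConj i

/-- For a reflection `t`, this is `1` if `t` is a right inversion of `w` and `0` otherwise. -/
noncomputable def inversionParity (w t : W) : ZMod 2 := (cs.signedConjHom w (t, 0)).2

theorem signedConjHom_apply (w t : W) (e : ZMod 2) :
    cs.signedConjHom w (t, e) = (w * t * w⁻¹, e + cs.inversionParity w t) := by
  classical
  unfold inversionParity
  induction w using cs.simple_induction_left generalizing t e with
  | one => simp
  | mul_simple_left w i ih =>
    rw [map_mul, Equiv.Perm.mul_apply, Equiv.Perm.mul_apply, ih t e, ih t 0, signedConjHom_simple,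
      signedConj_apply, signedConj_apply]
    simp [mul_assoc, add_assoc]

theorem inversionParity_mul (v w t : W) :
    cs.inversionParity (v * w) t =
      cs.inversionParity w t + cs.inversionParity v (w * t * w⁻¹) := by
  conv_lhs => rw [inversionParity, map_mul, Equiv.Perm.mul_apply]
  rw [signedConjHom_apply, signedConjHom_apply, zero_add]

@[simp]
theorem inversionParity_one (t : W) : cs.inversionParity 1 t = 0 := by
  simp [inversionParity]

open Classical in
theorem inversionParity_simple (i : B) (t : W) :
    cs.inversionParity (cs.simple i) t = if t = cs.simple i then 1 else 0 := by
  rw [inversionParity, signedConjHom_simple, signedConj_apply, zero_add]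

theorem inversionParity_wordProd_of_notMem {ω : List B} {t : W} (h : t ∉ cs.rightInvSeq ω) :
    cs.inversionParity (cs.wordProd ω) t = 0 := by
  classical
  induction ω with
  | nil => simp
  | cons i ω ih =>
    rw [rightInvSeq, List.mem_cons, not_or] at h
    rw [wordProd_cons, inversionParity_mul, ih h.2, inversionParity_simple, if_neg, add_zero]
    intro h'
    apply h.1
    rw [← h']
    group

theorem IsReflection.inversionParity_self {t : W} (ht : cs.IsReflection t) :
    cs.inversionParity t t = 1 := by
  obtain ⟨u, i, rfl⟩ := ht
  have h := cs.inversionParity_mul u u⁻¹ (u * cs.simple i * u⁻¹)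
  have hu : u⁻¹ * (u * cs.simple i * u⁻¹) * u⁻¹⁻¹ = cs.simple i := by group
  rw [mul_inv_cancel, inversionParity_one, hu] at h
  rw [inversionParity_mul, hu, inversionParity_mul, inversionParity_simple, if_pos rfl]
  simp only [simple_mul_simple_self, one_mul, inv_simple]
  rw [add_left_comm, ← h, add_zero]

theorem length_mul_lt_of_inversionParity_ne_zero {w t : W}
    (h : cs.inversionParity w t ≠ 0) : cs.length (w * t) < cs.length w := by
  obtain ⟨ω, hω, rfl⟩ := cs.exists_isReduced w
  by_contra hlt
  exact h (cs.inversionParity_wordProd_of_notMem fun hmem =>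
    hlt (cs.isRightInversion_of_mem_rightInvSeq hω hmem).2)

theorem IsReflection.inversionParity_eq_zero_iff {t : W} (ht : cs.IsReflection t) (w : W) :
    cs.inversionParity w t = 0 ↔ cs.length w < cs.length (w * t) := by
  constructor
  · intro h
    have h' : cs.inversionParity (w * t) t ≠ 0 := by
      rw [inversionParity_mul, ht.inversionParity_self, mul_inv_cancel_right, h]
      decide
    simpa [mul_assoc, ht.mul_self] using
      cs.length_mul_lt_of_inversionParity_ne_zero h'
  · intro h
    by_contra h'
    exact h.asymm (cs.length_mul_lt_of_inversionParity_ne_zero h')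

/-- A form of the strong exchange property. -/
theorem IsReflection.length_simple_mul_lt {t : W} (ht : cs.IsReflection t) {u : W} (i : B)
    (hlt : cs.length u < cs.length (u * t)) (hne : u * t ≠ cs.simple i * u) :
    cs.length (cs.simple i * u) < cs.length (cs.simple i * u * t) := by
  classical
  rw [← ht.inversionParity_eq_zero_iff] at hlt ⊢
  rw [inversionParity_mul, hlt, inversionParity_simple, if_neg, add_zero]
  rwa [mul_inv_eq_iff_eq_mul]

theorem bruhatLE_simple_mul {w : W} {i : B}
    (h : cs.length (cs.simple i * w) = cs.length w + 1) : cs.bruhatLE w (cs.simple i * w) := by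
  refine .single ⟨w⁻¹ * cs.simple i * w, ⟨w⁻¹, i, by simp⟩, by group, by omega⟩

theorem bruhatLE_simple_mul_left {u w : W} (h : cs.bruhatLE u w) (i : B) :
    cs.bruhatLE (cs.simple i * u) w ∨ cs.bruhatLE (cs.simple i * u) (cs.simple i * w) := by
  induction h using Relation.ReflTransGen.head_induction_on with
  | refl => exact .inr .refl
  | @head v _ huv hvw ih =>
    obtain ⟨t, ht, rfl, hlt⟩ := huv
    by_cases hne : v * t = cs.simple i * v
    · exact .inl (hne ▸ hvw)
    · have hstep := ht.length_simple_mul_lt cs i hlt hne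
      exact ih.imp (.head ⟨t, ht, (mul_assoc _ _ _).symm, by simpa [mul_assoc] using hstep⟩)
        (.head ⟨t, ht, (mul_assoc _ _ _).symm, by simpa [mul_assoc] using hstep⟩)

theorem bruhatLE_simple_mul_right {u w : W} (h : cs.bruhatLE u w) (i : B) :
    cs.bruhatLE u (cs.simple i * w) ∨ cs.bruhatLE (cs.simple i * u) (cs.simple i * w) := by
  induction h with
  | refl => exact .inr .refl
  | @tail v _ huv hvw ih =>
    obtain ⟨t, ht, rfl, hlt⟩ := hvw
    by_cases hne : v * t = cs.simple i * v
    · rw [hne, simple_mul_simple_cancel_left]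
      exact .inl huv
    · have hstep := ht.length_simple_mul_lt cs i hlt hne
      exact ih.imp (.tail · ⟨t, ht, (mul_assoc _ _ _).symm, by simpa [mul_assoc] using hstep⟩)
        (.tail · ⟨t, ht, (mul_assoc _ _ _).symm, by simpa [mul_assoc] using hstep⟩)

theorem bruhatLE_iff_simple_mul_bruhatLE_simple_mul {y w : W} {i : B}
    (hy : cs.length (cs.simple i * y) = cs.length y + 1)
    (hw : cs.length (cs.simple i * w) = cs.length w + 1) :
    cs.bruhatLE y w ↔ cs.bruhatLE (cs.simple i * y) (cs.simple i * w) := by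
  constructor
  · intro h
    exact (cs.bruhatLE_simple_mul_left h i).elim (·.trans (cs.bruhatLE_simple_mul hw)) id
  · intro h
    have h' := cs.bruhatLE_simple_mul_right h i
    simp only [simple_mul_simple_cancel_left] at h'
    exact h'.elim (cs.bruhatLE_simple_mul hy).trans id

end CoxeterSystem

/-- If `ℓ(xy) = ℓ(x) + ℓ(y)` and `ℓ(xw) = ℓ(x) + ℓ(w)`, then `y ≤ w` in the
Bruhat order if and only if `xy ≤ xw`. -/
theorem CoxeterSystem.bruhatLE_iff_mul_bruhatLE_mul
    {B W : Type*} [Group W] {M : CoxeterMatrix B} (cs : CoxeterSystem M W)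
    (x y w : W)
    (hxy : cs.length (x * y) = cs.length x + cs.length y)
    (hxw : cs.length (x * w) = cs.length x + cs.length w) :
    cs.bruhatLE y w ↔ cs.bruhatLE (x * y) (x * w) := by
  induction hn : cs.length x generalizing x with
  | zero =>
    rw [cs.length_eq_zero_iff] at hn
    simp [hn]
  | succ n ih =>
    have hx : x ≠ 1 := by
      rintro rfl
      simp at hn
    obtain ⟨i, hi⟩ := cs.exists_leftDescent_of_ne_one hx
    obtain ⟨x, rfl⟩ : ∃ v, x = cs.simple i * v := ⟨cs.simple i * x, by simp⟩
    rw [cs.isLeftDescent_iff, cs.simple_mul_simple_cancel_left] at hi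
    rw [mul_assoc] at hxy hxw ⊢
    rw [mul_assoc]
    have h₁ := cs.length_mul_le x y
    have h₂ := cs.length_mul_le x w
    have h₃ := cs.length_simple_mul (x * y) i
    have h₄ := cs.length_simple_mul (x * w) i
    rw [ih x (by omega) (by omega) (by omega)]
    exact cs.bruhatLE_iff_simple_mul_bruhatLE_simple_mul (by omega) (by omega)
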